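/- For every integer m ≥ 4, with n = 2^m − 1, there is no F_2-linear subspace C of F_2^n of dimension n − 1 − 2m such that every nonzero vector of C has Hamming weight at least 7. (In particular, a binary linear code with parameters [2^m − 1, 2^m − 2 − 2m, 6] is distance-optimal.) -/

import Mathlib

/-- Hamming weight of a vector: the number of nonzero coordinates. -/
noncomputable def hwt {R : Type*} [Zero R] {n : ℕ} (c : Fin n → R) : ℕ :=
  Set.ncard {i | c i ≠ 0}

theorem hwt_indicator_sub_indicator_le {R : Type*} [Ring R] {n : ℕ} (s t : Finset (Fin n)) :
    hwt ((s : Set (Fin n)).indicator (1 : Fin n → R) - (t : Set (Fin n)).indicator 1) ≤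
      s.card + t.card := by
  classical
  refine le_trans ?_ (Finset.card_union_le s t)
  rw [hwt, ← Set.ncard_coe_finset]
  refine Set.ncard_le_ncard (fun i hi => ?_) (Finset.finite_toSet _)
  by_contra hst
  simp only [Finset.coe_union, Set.mem_union, not_or] at hst
  exact hi (by simp [Set.indicator_of_notMem hst.1, Set.indicator_of_notMem hst.2])

/-- The Hamming (sphere-packing) bound for binary linear codes. -/
theorem sum_choose_le_two_pow_of_hwt {n t : ℕ} (C : Submodule (ZMod 2) (Fin n → ZMod 2))
    (hC : ∀ v ∈ C, v ≠ 0 → 2 * t + 1 ≤ hwt v) :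
    ∑ i ∈ Finset.range (t + 1), n.choose i ≤ 2 ^ (n - Module.finrank (ZMod 2) C) := by
  classical
  let S : Finset (Finset (Fin n)) :=
    (Finset.range (t + 1)).biUnion fun i => Finset.powersetCard i Finset.univ
  have mem_S {s : Finset (Fin n)} (hs : s ∈ S) : s.card ≤ t := by
    simp only [S, Finset.mem_biUnion, Finset.mem_range, Finset.mem_powersetCard] at hs
    omega
  have card_S : S.card = ∑ i ∈ Finset.range (t + 1), n.choose i := by
    rw [Finset.card_biUnion fun i _ j _ hij =>
      Finset.pairwise_disjoint_powersetCard Finset.univ hij]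
    simp
  have card_quotient : Nat.card ((Fin n → ZMod 2) ⧸ C) =
      2 ^ (n - Module.finrank (ZMod 2) C) := by
    have h := C.finrank_quotient_add_finrank
    rw [Module.finrank_fin_fun] at h
    rw [Module.natCard_eq_pow_finrank (K := ZMod 2), Nat.card_zmod]
    congr 1
    omega
  have : Finite ((Fin n → ZMod 2) ⧸ C) := Module.finite_of_finite (ZMod 2)
  have := Fintype.ofFinite ((Fin n → ZMod 2) ⧸ C)
  rw [← card_S, ← card_quotient, Nat.card_eq_fintype_card]
  refine Finset.card_le_card_of_injOn
    (fun s => C.mkQ ((s : Set (Fin n)).indicator 1)) (fun _ _ => Finset.mem_univ _) ?_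
  intro s hs u hu hsu
  have hmem := (Submodule.Quotient.eq C).1 hsu
  by_contra hne
  have hlt := hC _ hmem fun h0 => hne <| Finset.coe_injective <|
    Set.indicator_one_inj (ZMod 2) (sub_eq_zero.1 h0)
  have hle := hwt_indicator_sub_indicator_le (R := ZMod 2) s u
  have := mem_S hs
  have := mem_S hu
  omega

theorem two_pow_lt_sum_choose {m : ℕ} (hm : 4 ≤ m) :
    2 ^ (2 * m + 1) < ∑ i ∈ Finset.range 4, (2 ^ m - 1).choose i := by
  have hq : 2 ^ 4 ≤ 2 ^ m := Nat.pow_le_pow_right two_pos hm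
  obtain ⟨k, hk⟩ : ∃ k, 2 ^ m = k + 16 := ⟨2 ^ m - 16, by omega⟩
  have h2 := Nat.descFactorial_eq_factorial_mul_choose (k + 15) 2
  have h3 := Nat.descFactorial_eq_factorial_mul_choose (k + 15) 3
  simp only [Nat.descFactorial_succ, Nat.descFactorial_zero, Nat.factorial,
    show k + 15 - 1 = k + 14 by omega, show k + 15 - 2 = k + 13 by omega] at h2 h3
  rw [pow_succ, mul_comm 2 m, pow_mul, hk, show k + 16 - 1 = k + 15 by omega]
  simp only [Finset.sum_range_succ, Finset.sum_range_zero, Nat.choose_zero_right,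
    Nat.choose_one_right]
  norm_num at h2 h3
  nlinarith [Nat.zero_le (k ^ 3), Nat.zero_le (k ^ 2)]

/-- For `m ≥ 4` and `n = 2^m - 1`, there is no `F_2`-linear subspace of
`F_2^n` of dimension `n - 1 - 2m` in which every nonzero vector has Hamming weight
at least `7`. -/
theorem stmt9 (m : ℕ) (hm : 4 ≤ m) :
    ¬ ∃ C : Submodule (ZMod 2) (Fin (2 ^ m - 1) → ZMod 2),
      Module.finrank (ZMod 2) C = 2 ^ m - 1 - 1 - 2 * m ∧
      ∀ v ∈ C, v ≠ 0 → 7 ≤ hwt v := by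
  have hm_lt : 2 * m + 2 ≤ 2 ^ m := by
    induction m, hm using Nat.le_induction with
    | base => norm_num
    | succ k hk ih => rw [pow_succ]; omega
  rintro ⟨C, hdim, hC⟩
  have hbound := sum_choose_le_two_pow_of_hwt (t := 3) C hC
  rw [hdim, show 2 ^ m - 1 - (2 ^ m - 1 - 1 - 2 * m) = 2 * m + 1 by omega] at hbound
  exact absurd hbound (two_pow_lt_sum_choose hm).not_ge
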